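/- arXiv:1308.0955 — 3 statements merged into one kernel-verified Lean document; each statement's English description precedes it below -/
import Mathlib

section
/- In ℤ[λ₁,λ₂,μ₁,μ₂], let α = −λ₁³μ₁²μ₂ − λ₁²λ₂μ₂³ − λ₁λ₂²μ₁³ + λ₂³μ₁μ₂² and β = −λ₁⁴μ₁μ₂³ + λ₁³λ₂μ₁⁴ + 3λ₁²λ₂²μ₁²μ₂² − λ₁λ₂³μ₂⁴ + λ₂⁴μ₁³μ₂, and define N₁ = (7λ₁⁵λ₂² + λ₂⁷)μ₁ + (−λ₁⁷ + 7λ₁²λ₂⁵)μ₂ and M₁ = (λ₁¹³ − 39λ₁⁸λ₂⁵ − 26λ₁³λ₂¹⁰)μ₁ + (−26λ₁¹⁰λ₂³ + 39λ₁⁵λ₂⁸ + λ₂¹³)μ₂. Then: (i) Σ_{i=0}^{3} ((−1)^i/(i!(3−i)!))·(∂³α/∂μ₁^{3−i}∂μ₂^{i})·(∂³β/∂μ₁^{i}∂μ₂^{3−i}) = 6N₁; and (ii) with G = Σ_{i=0}^{2} ((−1)^i/(i!(2−i)!))·(∂²α/∂μ₁^{2−i}∂μ₂^{i})·(∂²α/∂μ₁^{i}∂μ₂^{2−i}),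 one has (∂G/∂μ₁)(∂N₁/∂μ₂) − (∂G/∂μ₂)(∂N₁/∂μ₁) = 8M₁. -/
open MvPolynomial

namespace Stmt12

/-- Coefficient form `α` (variables `X 0 = λ₁`, `X 1 = λ₂`, `X 2 = μ₁`, `X 3 = μ₂`). -/
noncomputable def coeffA : MvPolynomial (Fin 4) ℚ :=
  -(X 0) ^ 3 * (X 2) ^ 2 * X 3 - (X 0) ^ 2 * X 1 * (X 3) ^ 3
    - X 0 * (X 1) ^ 2 * (X 2) ^ 3 + (X 1) ^ 3 * X 2 * (X 3) ^ 2

/-- Coefficient form `β`. -/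
noncomputable def coeffB : MvPolynomial (Fin 4) ℚ :=
  -(X 0) ^ 4 * X 2 * (X 3) ^ 3 + (X 0) ^ 3 * X 1 * (X 2) ^ 4
    + 3 * (X 0) ^ 2 * (X 1) ^ 2 * (X 2) ^ 2 * (X 3) ^ 2
    - X 0 * (X 1) ^ 3 * (X 3) ^ 4 + (X 1) ^ 4 * (X 2) ^ 3 * X 3

/-- The invariant form `N₁`, linear in `μ₁, μ₂`. -/
noncomputable def N₁ : MvPolynomial (Fin 4) ℚ :=
  (7 * (X 0) ^ 5 * (X 1) ^ 2 + (X 1) ^ 7) * X 2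
    + (-(X 0) ^ 7 + 7 * (X 0) ^ 2 * (X 1) ^ 5) * X 3

/-- The invariant form `M₁`, linear in `μ₁, μ₂`. -/
noncomputable def M₁ : MvPolynomial (Fin 4) ℚ :=
  ((X 0) ^ 13 - 39 * (X 0) ^ 8 * (X 1) ^ 5 - 26 * (X 0) ^ 3 * (X 1) ^ 10) * X 2
    + (-26 * (X 0) ^ 10 * (X 1) ^ 3 + 39 * (X 0) ^ 5 * (X 1) ^ 8 + (X 1) ^ 13) * X 3

/-- Iterated partial derivative in the variable `i`. -/
noncomputable def pd (i : Fin 4) (n : ℕ) (p : MvPolynomial (Fin 4) ℚ) :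
    MvPolynomial (Fin 4) ℚ :=
  (fun q => pderiv i q)^[n] p

/-- The `μ`-transvectant `(α,α)_{0,2}`. -/
noncomputable def G : MvPolynomial (Fin 4) ℚ :=
  ∑ i ∈ Finset.range 3,
    C ((-1 : ℚ) ^ i / ((Nat.factorial i * Nat.factorial (2 - i) : ℕ) : ℚ)) *
      pd 2 (2 - i) (pd 3 i coeffA) * pd 2 i (pd 3 (2 - i) coeffA)

theorem pderiv_ofNat_eq (i : Fin 4) (n : ℕ) [n.AtLeastTwo] :
    pderiv i (ofNat(n) : MvPolynomial (Fin 4) ℚ) = 0 := by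
  change pderiv i ((OfNat.ofNat n : ℕ) : MvPolynomial (Fin 4) ℚ) = 0
  exact Derivation.map_natCast _ _

/-- Explicit form of `G`. -/
theorem G_eq : G = 12 * X 0 ^ 5 * X 1 * X 3 ^ 2 + 40 * X 0 ^ 3 * X 1 ^ 3 * X 2 * X 3
    - 12 * X 0 * X 1 ^ 5 * X 2 ^ 2 - 4 * X 0 ^ 6 * X 2 ^ 2 - 4 * X 1 ^ 6 * X 3 ^ 2 := by
  have h2 : (C (1 / 2 : ℚ) : MvPolynomial (Fin 4) ℚ) * 2 = 1 := by
    rw [show (2 : MvPolynomial (Fin 4) ℚ) = C 2 from (map_ofNat C 2).symm, ← C_mul]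
    norm_num
  have e0 : ((-1 : ℚ) ^ 0 / ((Nat.factorial 0 * Nat.factorial (2 - 0) : ℕ) : ℚ)) = 1 / 2 := by
    norm_num [Nat.factorial]
  have e1 : ((-1 : ℚ) ^ 1 / ((Nat.factorial 1 * Nat.factorial (2 - 1) : ℕ) : ℚ)) = -1 := by
    norm_num [Nat.factorial]
  have e2 : ((-1 : ℚ) ^ 2 / ((Nat.factorial 2 * Nat.factorial (2 - 2) : ℕ) : ℚ)) = 1 / 2 := by
    norm_num [Nat.factorial]
  rw [G, Finset.sum_range_succ, Finset.sum_range_succ, Finset.sum_range_succ,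
    Finset.sum_range_zero, e0, e1, e2]
  simp [pd, coeffA, pderiv_ofNat_eq, Derivation.leibniz, Derivation.leibniz_pow,
    -one_div, -map_div₀]
  generalize (C (1 / 2 : ℚ) : MvPolynomial (Fin 4) ℚ) = c at *
  linear_combination ((-2 * X 0 ^ 3 * X 3 - 6 * X 0 * X 1 ^ 2 * X 2) * (-6 * X 0 ^ 2 * X 1 * X 3 + 2 * X 1 ^ 3 * X 2)) * h2

theorem coeffA_30 : pd 2 3 (pd 3 0 coeffA) =
    -(6 * X 0 * X 1 ^ 2) := by
  obtain ⟨s0, s1, s2⟩ :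
      pderiv 2 coeffA =
        -(2 * X 0 ^ 3 * X 2 * X 3) - 3 * X 0 * X 1 ^ 2 * X 2 ^ 2 + X 1 ^ 3 * X 3 ^ 2 ∧
      pderiv 2 (-(2 * X 0 ^ 3 * X 2 * X 3) - 3 * X 0 * X 1 ^ 2 * X 2 ^ 2 + X 1 ^ 3 * X 3 ^ 2 : MvPolynomial (Fin 4) ℚ) =
        -(2 * X 0 ^ 3 * X 3) - 6 * X 0 * X 1 ^ 2 * X 2 ∧
      pderiv 2 (-(2 * X 0 ^ 3 * X 3) - 6 * X 0 * X 1 ^ 2 * X 2 : MvPolynomial (Fin 4) ℚ) =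
        -(6 * X 0 * X 1 ^ 2) := by
    refine ⟨?_, ?_, ?_⟩ <;>
      simp [coeffA, pderiv_ofNat_eq, Derivation.leibniz, Derivation.leibniz_pow] <;> try ring
  simp only [pd, Function.iterate_succ_apply, Function.iterate_zero_apply]
  rw [s0, s1, s2]

theorem coeffA_21 : pd 2 2 (pd 3 1 coeffA) =
    -(2 * X 0 ^ 3) := by
  obtain ⟨s0, s1, s2⟩ :
      pderiv 3 coeffA =
        -(X 0 ^ 3 * X 2 ^ 2) - 3 * X 0 ^ 2 * X 1 * X 3 ^ 2 + 2 * X 1 ^ 3 * X 2 * X 3 ∧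
      pderiv 2 (-(X 0 ^ 3 * X 2 ^ 2) - 3 * X 0 ^ 2 * X 1 * X 3 ^ 2 + 2 * X 1 ^ 3 * X 2 * X 3 : MvPolynomial (Fin 4) ℚ) =
        -(2 * X 0 ^ 3 * X 2) + 2 * X 1 ^ 3 * X 3 ∧
      pderiv 2 (-(2 * X 0 ^ 3 * X 2) + 2 * X 1 ^ 3 * X 3 : MvPolynomial (Fin 4) ℚ) =
        -(2 * X 0 ^ 3) := by
    refine ⟨?_, ?_, ?_⟩ <;>
      simp [coeffA, pderiv_ofNat_eq, Derivation.leibniz, Derivation.leibniz_pow] <;> try ring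
  simp only [pd, Function.iterate_succ_apply, Function.iterate_zero_apply]
  rw [s0, s1, s2]

theorem coeffA_12 : pd 2 1 (pd 3 2 coeffA) =
    2 * X 1 ^ 3 := by
  obtain ⟨s0, s1, s2⟩ :
      pderiv 3 coeffA =
        -(X 0 ^ 3 * X 2 ^ 2) - 3 * X 0 ^ 2 * X 1 * X 3 ^ 2 + 2 * X 1 ^ 3 * X 2 * X 3 ∧
      pderiv 3 (-(X 0 ^ 3 * X 2 ^ 2) - 3 * X 0 ^ 2 * X 1 * X 3 ^ 2 + 2 * X 1 ^ 3 * X 2 * X 3 : MvPolynomial (Fin 4) ℚ) =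
        -(6 * X 0 ^ 2 * X 1 * X 3) + 2 * X 1 ^ 3 * X 2 ∧
      pderiv 2 (-(6 * X 0 ^ 2 * X 1 * X 3) + 2 * X 1 ^ 3 * X 2 : MvPolynomial (Fin 4) ℚ) =
        2 * X 1 ^ 3 := by
    refine ⟨?_, ?_, ?_⟩ <;>
      simp [coeffA, pderiv_ofNat_eq, Derivation.leibniz, Derivation.leibniz_pow] <;> try ring
  simp only [pd, Function.iterate_succ_apply, Function.iterate_zero_apply]
  rw [s0, s1, s2]

theorem coeffA_03 : pd 2 0 (pd 3 3 coeffA) =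
    -(6 * X 0 ^ 2 * X 1) := by
  obtain ⟨s0, s1, s2⟩ :
      pderiv 3 coeffA =
        -(X 0 ^ 3 * X 2 ^ 2) - 3 * X 0 ^ 2 * X 1 * X 3 ^ 2 + 2 * X 1 ^ 3 * X 2 * X 3 ∧
      pderiv 3 (-(X 0 ^ 3 * X 2 ^ 2) - 3 * X 0 ^ 2 * X 1 * X 3 ^ 2 + 2 * X 1 ^ 3 * X 2 * X 3 : MvPolynomial (Fin 4) ℚ) =
        -(6 * X 0 ^ 2 * X 1 * X 3) + 2 * X 1 ^ 3 * X 2 ∧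
      pderiv 3 (-(6 * X 0 ^ 2 * X 1 * X 3) + 2 * X 1 ^ 3 * X 2 : MvPolynomial (Fin 4) ℚ) =
        -(6 * X 0 ^ 2 * X 1) := by
    refine ⟨?_, ?_, ?_⟩ <;>
      simp [coeffA, pderiv_ofNat_eq, Derivation.leibniz, Derivation.leibniz_pow] <;> try ring
  simp only [pd, Function.iterate_succ_apply, Function.iterate_zero_apply]
  rw [s0, s1, s2]

theorem coeffB_30 : pd 2 3 (pd 3 0 coeffB) =
    24 * X 0 ^ 3 * X 1 * X 2 + 6 * X 1 ^ 4 * X 3 := by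
  obtain ⟨s0, s1, s2⟩ :
      pderiv 2 coeffB =
        -(X 0 ^ 4 * X 3 ^ 3) + 4 * X 0 ^ 3 * X 1 * X 2 ^ 3 + 6 * X 0 ^ 2 * X 1 ^ 2 * X 2 * X 3 ^ 2 + 3 * X 1 ^ 4 * X 2 ^ 2 * X 3 ∧
      pderiv 2 (-(X 0 ^ 4 * X 3 ^ 3) + 4 * X 0 ^ 3 * X 1 * X 2 ^ 3 + 6 * X 0 ^ 2 * X 1 ^ 2 * X 2 * X 3 ^ 2 + 3 * X 1 ^ 4 * X 2 ^ 2 * X 3 : MvPolynomial (Fin 4) ℚ) =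
        12 * X 0 ^ 3 * X 1 * X 2 ^ 2 + 6 * X 0 ^ 2 * X 1 ^ 2 * X 3 ^ 2 + 6 * X 1 ^ 4 * X 2 * X 3 ∧
      pderiv 2 (12 * X 0 ^ 3 * X 1 * X 2 ^ 2 + 6 * X 0 ^ 2 * X 1 ^ 2 * X 3 ^ 2 + 6 * X 1 ^ 4 * X 2 * X 3 : MvPolynomial (Fin 4) ℚ) =
        24 * X 0 ^ 3 * X 1 * X 2 + 6 * X 1 ^ 4 * X 3 := by
    refine ⟨?_, ?_, ?_⟩ <;>
      simp [coeffB, pderiv_ofNat_eq, Derivation.leibniz, Derivation.leibniz_pow] <;> try ring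
  simp only [pd, Function.iterate_succ_apply, Function.iterate_zero_apply]
  rw [s0, s1, s2]

theorem coeffB_21 : pd 2 2 (pd 3 1 coeffB) =
    12 * X 0 ^ 2 * X 1 ^ 2 * X 3 + 6 * X 1 ^ 4 * X 2 := by
  obtain ⟨s0, s1, s2⟩ :
      pderiv 3 coeffB =
        -(3 * X 0 ^ 4 * X 2 * X 3 ^ 2) + 6 * X 0 ^ 2 * X 1 ^ 2 * X 2 ^ 2 * X 3 - 4 * X 0 * X 1 ^ 3 * X 3 ^ 3 + X 1 ^ 4 * X 2 ^ 3 ∧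
      pderiv 2 (-(3 * X 0 ^ 4 * X 2 * X 3 ^ 2) + 6 * X 0 ^ 2 * X 1 ^ 2 * X 2 ^ 2 * X 3 - 4 * X 0 * X 1 ^ 3 * X 3 ^ 3 + X 1 ^ 4 * X 2 ^ 3 : MvPolynomial (Fin 4) ℚ) =
        -(3 * X 0 ^ 4 * X 3 ^ 2) + 12 * X 0 ^ 2 * X 1 ^ 2 * X 2 * X 3 + 3 * X 1 ^ 4 * X 2 ^ 2 ∧
      pderiv 2 (-(3 * X 0 ^ 4 * X 3 ^ 2) + 12 * X 0 ^ 2 * X 1 ^ 2 * X 2 * X 3 + 3 * X 1 ^ 4 * X 2 ^ 2 : MvPolynomial (Fin 4) ℚ) =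
        12 * X 0 ^ 2 * X 1 ^ 2 * X 3 + 6 * X 1 ^ 4 * X 2 := by
    refine ⟨?_, ?_, ?_⟩ <;>
      simp [coeffB, pderiv_ofNat_eq, Derivation.leibniz, Derivation.leibniz_pow] <;> try ring
  simp only [pd, Function.iterate_succ_apply, Function.iterate_zero_apply]
  rw [s0, s1, s2]

theorem coeffB_12 : pd 2 1 (pd 3 2 coeffB) =
    -(6 * X 0 ^ 4 * X 3) + 12 * X 0 ^ 2 * X 1 ^ 2 * X 2 := by
  obtain ⟨s0, s1, s2⟩ :
      pderiv 3 coeffB =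
        -(3 * X 0 ^ 4 * X 2 * X 3 ^ 2) + 6 * X 0 ^ 2 * X 1 ^ 2 * X 2 ^ 2 * X 3 - 4 * X 0 * X 1 ^ 3 * X 3 ^ 3 + X 1 ^ 4 * X 2 ^ 3 ∧
      pderiv 3 (-(3 * X 0 ^ 4 * X 2 * X 3 ^ 2) + 6 * X 0 ^ 2 * X 1 ^ 2 * X 2 ^ 2 * X 3 - 4 * X 0 * X 1 ^ 3 * X 3 ^ 3 + X 1 ^ 4 * X 2 ^ 3 : MvPolynomial (Fin 4) ℚ) =
        -(6 * X 0 ^ 4 * X 2 * X 3) + 6 * X 0 ^ 2 * X 1 ^ 2 * X 2 ^ 2 - 12 * X 0 * X 1 ^ 3 * X 3 ^ 2 ∧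
      pderiv 2 (-(6 * X 0 ^ 4 * X 2 * X 3) + 6 * X 0 ^ 2 * X 1 ^ 2 * X 2 ^ 2 - 12 * X 0 * X 1 ^ 3 * X 3 ^ 2 : MvPolynomial (Fin 4) ℚ) =
        -(6 * X 0 ^ 4 * X 3) + 12 * X 0 ^ 2 * X 1 ^ 2 * X 2 := by
    refine ⟨?_, ?_, ?_⟩ <;>
      simp [coeffB, pderiv_ofNat_eq, Derivation.leibniz, Derivation.leibniz_pow] <;> try ring
  simp only [pd, Function.iterate_succ_apply, Function.iterate_zero_apply]
  rw [s0, s1, s2]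

theorem coeffB_03 : pd 2 0 (pd 3 3 coeffB) =
    -(6 * X 0 ^ 4 * X 2) - 24 * X 0 * X 1 ^ 3 * X 3 := by
  obtain ⟨s0, s1, s2⟩ :
      pderiv 3 coeffB =
        -(3 * X 0 ^ 4 * X 2 * X 3 ^ 2) + 6 * X 0 ^ 2 * X 1 ^ 2 * X 2 ^ 2 * X 3 - 4 * X 0 * X 1 ^ 3 * X 3 ^ 3 + X 1 ^ 4 * X 2 ^ 3 ∧
      pderiv 3 (-(3 * X 0 ^ 4 * X 2 * X 3 ^ 2) + 6 * X 0 ^ 2 * X 1 ^ 2 * X 2 ^ 2 * X 3 - 4 * X 0 * X 1 ^ 3 * X 3 ^ 3 + X 1 ^ 4 * X 2 ^ 3 : MvPolynomial (Fin 4) ℚ) =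
        -(6 * X 0 ^ 4 * X 2 * X 3) + 6 * X 0 ^ 2 * X 1 ^ 2 * X 2 ^ 2 - 12 * X 0 * X 1 ^ 3 * X 3 ^ 2 ∧
      pderiv 3 (-(6 * X 0 ^ 4 * X 2 * X 3) + 6 * X 0 ^ 2 * X 1 ^ 2 * X 2 ^ 2 - 12 * X 0 * X 1 ^ 3 * X 3 ^ 2 : MvPolynomial (Fin 4) ℚ) =
        -(6 * X 0 ^ 4 * X 2) - 24 * X 0 * X 1 ^ 3 * X 3 := by
    refine ⟨?_, ?_, ?_⟩ <;>
      simp [coeffB, pderiv_ofNat_eq, Derivation.leibniz, Derivation.leibniz_pow] <;> try ring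
  simp only [pd, Function.iterate_succ_apply, Function.iterate_zero_apply]
  rw [s0, s1, s2]

/-- The transvectant identities `(α,β)_{0,3} = 6N₁` and `((α,α)_{0,2}, N₁)_{0,1} = 8M₁`. -/
theorem transvectant_identities :
    (∑ i ∈ Finset.range 4,
        C ((-1 : ℚ) ^ i / ((Nat.factorial i * Nat.factorial (3 - i) : ℕ) : ℚ)) *
          pd 2 (3 - i) (pd 3 i coeffA) * pd 2 i (pd 3 (3 - i) coeffB) = 6 * N₁) ∧
      (pderiv 2 G * pderiv 3 N₁ - pderiv 3 G * pderiv 2 N₁ = 8 * M₁) := by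
  have h6 : (C (1 / 6 : ℚ) : MvPolynomial (Fin 4) ℚ) * 6 = 1 := by
    rw [show (6 : MvPolynomial (Fin 4) ℚ) = C 6 from (map_ofNat C 6).symm, ← C_mul]
    norm_num
  have e0 : ((-1 : ℚ) ^ 0 / ((Nat.factorial 0 * Nat.factorial (3 - 0) : ℕ) : ℚ)) = 1 / 6 := by
    norm_num [Nat.factorial]
  have e1 : ((-1 : ℚ) ^ 1 / ((Nat.factorial 1 * Nat.factorial (3 - 1) : ℕ) : ℚ))
      = -(1 / 6) * 3 := by
    norm_num [Nat.factorial]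
  have e2 : ((-1 : ℚ) ^ 2 / ((Nat.factorial 2 * Nat.factorial (3 - 2) : ℕ) : ℚ))
      = (1 / 6) * 3 := by
    norm_num [Nat.factorial]
  have e3 : ((-1 : ℚ) ^ 3 / ((Nat.factorial 3 * Nat.factorial (3 - 3) : ℕ) : ℚ))
      = -(1 / 6) := by
    norm_num [Nat.factorial]
  have c3 : (C (3 : ℚ) : MvPolynomial (Fin 4) ℚ) = 3 := map_ofNat C 3
  constructor
  · rw [Finset.sum_range_succ, Finset.sum_range_succ, Finset.sum_range_succ,
      Finset.sum_range_succ, Finset.sum_range_zero, e0, e1, e2, e3, C_mul, C_mul, C_neg, c3]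
    simp only [Nat.sub_zero, Nat.sub_self, Nat.reduceSub]
    rw [coeffA_30, coeffA_21, coeffA_12, coeffA_03, coeffB_30, coeffB_21, coeffB_12, coeffB_03,
      N₁]
    generalize (C (1 / 6 : ℚ) : MvPolynomial (Fin 4) ℚ) = c at *
    linear_combination (6 * ((7 * (X 0) ^ 5 * (X 1) ^ 2 + (X 1) ^ 7) * X 2
      + (-(X 0) ^ 7 + 7 * (X 0) ^ 2 * (X 1) ^ 5) * X 3)) * h6
  · rw [G_eq]
    simp [N₁, M₁, pderiv_ofNat_eq, Derivation.leibniz, Derivation.leibniz_pow]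
    ring

end Stmt12
end

section
/- Let m ≥ 1 and let a₁, …, a_m be integers with a₁ + ⋯ + a_m = 1. Then there is exactly one index r ∈ {0, 1, …, m−1} such that the cyclic rotation a_{r+1}, a_{r+2}, …, a_m, a₁, …, a_r has all of its partial sums positive (i.e., for every j with 1 ≤ j ≤ m, the sum of the first j terms of the rotated sequence is ≥ 1). -/
open Finset

/-- Raney's cycle lemma: if `a₁ + ⋯ + a_m = 1` (integers, `m ≥ 1`), then exactly one of the
`m` cyclic rotations of the sequence has all of its partial sums positive. -/
theorem raney_cycle_lemma (m : ℕ) (hm : 1 ≤ m) (a : ℕ → ℤ)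
    (hsum : ∑ i ∈ Finset.range m, a i = 1) :
    ∃! r, r ∈ Finset.range m ∧
      ∀ j, 1 ≤ j → j ≤ m → 1 ≤ ∑ t ∈ Finset.range j, a ((r + t) % m) := by
  obtain ⟨S, hS⟩ : ∃ S : ℕ → ℤ, ∀ n, S n = ∑ i ∈ Finset.range n, a (i % m) := ⟨_, fun _ => rfl⟩
  have hadd : ∀ r j, ∑ t ∈ Finset.range j, a ((r + t) % m) = S (r + j) - S r := by
    intro r j
    rw [hS, hS, Finset.sum_range_add]
    ring
  have hSm : S m = 1 := by
    rw [hS, ← hsum]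
    refine Finset.sum_congr rfl fun i hi => ?_
    rw [Nat.mod_eq_of_lt (Finset.mem_range.1 hi)]
  have hper : ∀ n, S (m + n) = S n + 1 := by
    intro n
    have h := hadd m n
    simp only [Nat.add_mod_left] at h
    rw [← hS] at h
    omega
  simp only [hadd]
  have huniq : ∀ r s, r < s → s < m → (∀ j, 1 ≤ j → j ≤ m → 1 ≤ S (r + j) - S r) →
      (∀ j, 1 ≤ j → j ≤ m → 1 ≤ S (s + j) - S s) → False := by
    intro r s hrs hsm h1 h2
    have e1 := h1 (s - r) (by omega) (by omega)
    have e2 := h2 (m + r - s) (by omega) (by omega)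
    rw [show r + (s - r) = s by omega] at e1
    rw [show s + (m + r - s) = m + r by omega, hper] at e2
    omega
  obtain ⟨r, hr, hmin⟩ := Finset.exists_min_image (Finset.range m)
    (fun n => (m : ℤ) * S n - n) ⟨0, Finset.mem_range.2 hm⟩
  have hr' := Finset.mem_range.1 hr
  have hex : ∀ j, 1 ≤ j → j ≤ m → 1 ≤ S (r + j) - S r := by
    intro j h1 h2
    rcases lt_or_ge (r + j) m with h | h
    · have := hmin (r + j) (Finset.mem_range.2 h)
      push_cast at this
      by_contra hc
      have : (m : ℤ) * (S (r + j) - S r) ≤ 0 :=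
        mul_nonpos_of_nonneg_of_nonpos (by omega) (by omega)
      rw [mul_sub] at this
      omega
    · obtain ⟨k, hk⟩ := Nat.exists_eq_add_of_le h
      have := hmin k (Finset.mem_range.2 (by omega))
      rw [hk, hper]
      by_contra hc
      have h3 : (m : ℤ) * (S k - S r) ≤ m * (-1) :=
        mul_le_mul_of_nonneg_left (by omega) (by omega)
      rw [mul_sub] at h3
      omega
  refine ⟨r, ⟨hr, hex⟩, ?_⟩
  · rintro s ⟨hs, h⟩
    have hs' := Finset.mem_range.1 hs
    rcases lt_trichotomy s r with hlt | heq | hlt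
    · exact (huniq s r hlt hr' h hex).elim
    · exact heq
    · exact (huniq r s hlt hs' hex h).elim
end

section
/- Let p ≥ 1 and k ≥ 0 be integers. The number of sequences a₀, a₁, …, a_{kp} of integers such that (i) each a_i is either 1 or 1−p, (ii) a₀ + a₁ + ⋯ + a_{kp} = 1, and (iii) every partial sum a₀ + ⋯ + a_j (for 0 ≤ j ≤ kp) is positive, equals C(pk, k)/((p−1)k + 1), where C(pk,k) is the binomial coefficient. -/
open Finset

/-- periodic extension -/
def fcExt {n : ℕ} [NeZero n] (a : Fin n → ℤ) (i : ℕ) : ℤ := a (Fin.ofNat n i)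

/-- partial sums of the periodic extension -/
def fcP {n : ℕ} [NeZero n] (a : Fin n → ℤ) (j : ℕ) : ℤ := ∑ i ∈ range j, fcExt a i

/-- rotation -/
def fcRot {n : ℕ} [NeZero n] (s : Fin n) (a : Fin n → ℤ) : Fin n → ℤ := fun i => a (i + s)

/-- all partial sums positive -/
def fcPos {n : ℕ} (a : Fin n → ℤ) : Prop :=
  ∀ j : Fin n, 1 ≤ ∑ i ∈ Finset.univ.filter (fun i => i ≤ j), a i

lemma fcExt_add {n : ℕ} [NeZero n] (a : Fin n → ℤ) (i : ℕ) : fcExt a (i + n) = fcExt a i := by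
  unfold fcExt
  congr 1
  ext
  simp [Fin.ofNat]

lemma fcP_n {n : ℕ} [NeZero n] (a : Fin n → ℤ) : fcP a n = ∑ i, a i := by
  unfold fcP
  rw [Finset.sum_range]
  refine Finset.sum_congr rfl fun i _ => ?_
  unfold fcExt
  congr 1
  ext
  simp [Fin.ofNat, Nat.mod_eq_of_lt i.2]

lemma fcP_add {n : ℕ} [NeZero n] (a : Fin n → ℤ) (h : ∑ i, a i = 1) (j : ℕ) :
    fcP a (j + n) = fcP a j + 1 := by
  induction j with
  | zero => rw [zero_add, fcP_n, h]; simp [fcP]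
  | succ j ih =>
    have h1 : fcP a (j + 1) = fcP a j + fcExt a j := by simp [fcP, Finset.sum_range_succ]
    have h2 : fcP a (j + n + 1) = fcP a (j + n) + fcExt a (j + n) := by
      simp [fcP, Finset.sum_range_succ]
    rw [show j + 1 + n = j + n + 1 by ring, h1, h2, ih, fcExt_add]
    ring

lemma fcRot_sum {n : ℕ} [NeZero n] (a : Fin n → ℤ) (s j : Fin n) :
    ∑ i ∈ Finset.univ.filter (fun i => i ≤ j), fcRot s a i
      = fcP a (s.1 + (j.1 + 1)) - fcP a s.1 := by
  unfold fcP
  rw [Finset.sum_range_add, add_sub_cancel_left]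
  refine Finset.sum_bij (fun i _ => i.1) ?_ ?_ ?_ ?_
  · intro i hi
    simp only [mem_filter, mem_univ, true_and, Fin.le_def] at hi
    simp only [mem_range]; omega
  · intro i _ i' _ h
    exact Fin.ext h
  · intro b hb
    simp only [mem_range] at hb
    have := j.2
    refine ⟨⟨b, by omega⟩, ?_, rfl⟩
    simp only [mem_filter, mem_univ, true_and, Fin.le_def]
    omega
  · intro i _
    unfold fcRot fcExt
    congr 1
    ext
    simp [Fin.ofNat, Fin.val_add, add_comm]

lemma fc_exists {n : ℕ} [NeZero n] (a : Fin n → ℤ) (h : ∑ i, a i = 1) :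
    ∃ s : Fin n, fcPos (fcRot s a) := by
  have hn : 0 < n := Nat.pos_of_ne_zero (NeZero.ne n)
  obtain ⟨s, -, hs⟩ := Finset.exists_min_image (Finset.univ : Finset (Fin n))
    (fun s => (n : ℤ) * fcP a s.1 - s.1) ⟨⟨0, hn⟩, mem_univ _⟩
  have key : ∀ j : ℕ, (n : ℤ) * fcP a s.1 - s.1 ≤ (n : ℤ) * fcP a j - j := by
    intro j
    induction j using Nat.strong_induction_on with
    | _ j ih =>
      by_cases hj : j < n
      · exact hs ⟨j, hj⟩ (mem_univ _)
      · obtain ⟨m, rfl⟩ : ∃ m, j = m + n := ⟨j - n, by omega⟩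
        have := ih m (by omega)
        rw [fcP_add a h]
        push_cast
        linarith
  refine ⟨s, fun j => ?_⟩
  rw [fcRot_sum]
  have := key (s.1 + (j.1 + 1))
  push_cast at this
  by_contra hc
  have h1 : fcP a (s.1 + (j.1 + 1)) - fcP a s.1 ≤ 0 := by omega
  have h2 : (n : ℤ) * (fcP a (s.1 + (j.1 + 1)) - fcP a s.1) ≤ 0 :=
    mul_nonpos_of_nonneg_of_nonpos (by positivity) h1
  rw [mul_sub] at h2
  have h3 : (0 : ℤ) ≤ (j.1 : ℤ) := by positivity
  linarith

lemma fc_unique_aux {n : ℕ} [NeZero n] (a : Fin n → ℤ) (h : ∑ i, a i = 1) (s t : Fin n)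
    (hs : fcPos (fcRot s a)) (ht : fcPos (fcRot t a)) : ¬ s.1 < t.1 := by
  intro hlt
  have h1 := hs ⟨t.1 - s.1 - 1, by omega⟩
  have h2 := ht ⟨s.1 + n - t.1 - 1, by omega⟩
  rw [fcRot_sum] at h1 h2
  simp only at h1 h2
  rw [show s.1 + (t.1 - s.1 - 1 + 1) = t.1 by omega] at h1
  rw [show t.1 + (s.1 + n - t.1 - 1 + 1) = s.1 + n by omega, fcP_add a h] at h2
  linarith

lemma fc_existsUnique {n : ℕ} [NeZero n] (a : Fin n → ℤ) (h : ∑ i, a i = 1) :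
    ∃! s : Fin n, fcPos (fcRot s a) := by
  obtain ⟨s, hs⟩ := fc_exists a h
  refine ⟨s, hs, fun t ht => Fin.ext ?_⟩
  have := fc_unique_aux a h s t hs ht
  have := fc_unique_aux a h t s ht hs
  omega

/-- the sequence with value `1 - p` exactly on `T` -/
def fcSeq {n : ℕ} (p : ℕ) (T : Finset (Fin n)) : Fin n → ℤ :=
  fun i => if i ∈ T then 1 - (p : ℤ) else 1

lemma fcSeq_inj {n p : ℕ} (hp : 1 ≤ p) : Function.Injective (fcSeq (n := n) p) := by
  intro T U h
  ext i
  have := congrFun h i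
  unfold fcSeq at this
  split_ifs at this <;> first | (exfalso; omega) | simp [*]

lemma fcSeq_sum {n p : ℕ} (T : Finset (Fin n)) : ∑ i, fcSeq p T i = n - p * T.card := by
  have : ∀ i, fcSeq p T i = 1 - (if i ∈ T then (p : ℤ) else 0) := by
    intro i; unfold fcSeq; split_ifs <;> simp
  simp [this, Finset.sum_sub_distrib, mul_comm]

/-- all admissible sequences, with no positivity -/
def fcAll (p k : ℕ) : Finset (Fin (k * p + 1) → ℤ) :=
  (powersetCard k univ).image (fcSeq p)

lemma fcAll_card {p k : ℕ} (hp : 1 ≤ p) : (fcAll p k).card = (k * p + 1).choose k := by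
  unfold fcAll
  rw [card_image_of_injective _ (fcSeq_inj hp)]
  simp

lemma mem_fcAll {p k : ℕ} (hp : 1 ≤ p) (a : Fin (k * p + 1) → ℤ) :
    a ∈ fcAll p k ↔ (∀ i, a i = 1 ∨ a i = 1 - (p : ℤ)) ∧ ∑ i, a i = 1 := by
  unfold fcAll
  simp only [mem_image, mem_powersetCard, subset_univ, true_and]
  constructor
  · rintro ⟨T, hT, rfl⟩
    refine ⟨fun i => ?_, ?_⟩
    · unfold fcSeq; split_ifs <;> simp
    · rw [fcSeq_sum, hT]; push_cast; ring
  · rintro ⟨h1, h2⟩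
    have e : fcSeq p (univ.filter fun i => a i = 1 - (p : ℤ)) = a := by
      ext i
      unfold fcSeq
      simp only [mem_filter, mem_univ, true_and]
      split_ifs with h
      · exact h.symm
      · exact ((h1 i).resolve_right h).symm
    refine ⟨_, ?_, e⟩
    rw [← e, fcSeq_sum] at h2
    push_cast at h2
    have hp' : (p : ℤ) ≠ 0 := by positivity
    have : (p : ℤ) * ((univ.filter fun i => a i = 1 - (p : ℤ)).card : ℤ) = p * k := by linarith
    exact_mod_cast mul_left_cancel₀ hp' this

lemma fcRot_mem {p k : ℕ} (hp : 1 ≤ p) (s : Fin (k * p + 1)) (a : Fin (k * p + 1) → ℤ)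
    (ha : a ∈ fcAll p k) : fcRot s a ∈ fcAll p k := by
  rw [mem_fcAll hp] at ha ⊢
  refine ⟨fun i => ha.1 _, ?_⟩
  rw [← ha.2]
  exact Equiv.sum_comp (Equiv.addRight s) a

open Classical in
lemma fc_count {p k : ℕ} (hp : 1 ≤ p) :
    (k * p + 1) * ((fcAll p k).filter fcPos).card = (k * p + 1).choose k := by
  have h1 : ∀ s : Fin (k * p + 1),
      ((fcAll p k).filter fun a => fcPos (fcRot s a)).card = ((fcAll p k).filter fcPos).card := by
    intro s
    refine Finset.card_bij' (fun a _ => fcRot s a) (fun a _ => fcRot (-s) a) ?_ ?_ ?_ ?_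
    · intro a ha
      rw [mem_filter] at ha ⊢
      exact ⟨fcRot_mem hp s a ha.1, ha.2⟩
    · intro a ha
      rw [mem_filter] at ha ⊢
      refine ⟨fcRot_mem hp _ a ha.1, ?_⟩
      have : fcRot s (fcRot (-s) a) = a := by ext i; simp [fcRot]
      rw [this]; exact ha.2
    · intro a _; ext i; simp [fcRot]
    · intro a _; ext i; simp [fcRot]
  have h2 : ∀ a ∈ fcAll p k,
      (univ.filter fun s : Fin (k * p + 1) => fcPos (fcRot s a)).card = 1 := by
    intro a ha
    obtain ⟨s, hs, hu⟩ := fc_existsUnique a ((mem_fcAll hp a).1 ha).2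
    rw [card_eq_one]
    refine ⟨s, ?_⟩
    ext t
    simp only [mem_filter, mem_univ, true_and, mem_singleton]
    exact ⟨hu t, fun h => h ▸ hs⟩
  have h3 := Finset.sum_card_bipartiteAbove_eq_sum_card_bipartiteBelow
    (s := fcAll p k) (t := (univ : Finset (Fin (k * p + 1)))) (fun a s => fcPos (fcRot s a))
  unfold bipartiteAbove bipartiteBelow at h3
  rw [Finset.sum_congr rfl h2, Finset.sum_congr rfl (fun s _ => h1 s)] at h3
  simp only [sum_const, smul_eq_mul, mul_one, card_univ, Fintype.card_fin] at h3
  rw [← h3, fcAll_card hp]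

/-- Fuss–Catalan count: the number of sequences `a₀, …, a_{kp}` with entries in `{1, 1−p}`,
total sum `1`, and all partial sums positive, is `C(pk,k)/((p−1)k+1)`. -/
theorem fuss_catalan_count (p k : ℕ) (hp : 1 ≤ p) :
    (Nat.card {a : Fin (k * p + 1) → ℤ //
        (∀ i, a i = 1 ∨ a i = 1 - (p : ℤ)) ∧
        (∑ i, a i = 1) ∧
        (∀ j : Fin (k * p + 1), 1 ≤ ∑ i ∈ Finset.univ.filter (fun i => i ≤ j), a i)} : ℚ) =
      (Nat.choose (p * k) k : ℚ) / (((p - 1) * k + 1 : ℕ) : ℚ) := by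
  classical
  have hc : Nat.card {a : Fin (k * p + 1) → ℤ //
        (∀ i, a i = 1 ∨ a i = 1 - (p : ℤ)) ∧
        (∑ i, a i = 1) ∧
        (∀ j : Fin (k * p + 1), 1 ≤ ∑ i ∈ Finset.univ.filter (fun i => i ≤ j), a i)}
      = ((fcAll p k).filter fcPos).card := by
    rw [← Nat.card_eq_finsetCard]
    refine Nat.card_congr (Equiv.subtypeEquivRight fun a => ?_)
    rw [mem_filter, mem_fcAll hp, and_assoc]
    rfl
  rw [hc, eq_div_iff (by positivity)]
  have h := fc_count (k := k) hp
  obtain ⟨q, rfl⟩ : ∃ q, p = q + 1 := ⟨p - 1, by omega⟩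
  have h4 := Nat.choose_mul_succ_eq (k * (q + 1)) k
  rw [← h, show k * (q + 1) + 1 - k = q * k + 1 by
    rw [show k * (q + 1) + 1 = q * k + 1 + k by ring, Nat.add_sub_cancel]] at h4
  rw [Nat.add_sub_cancel, mul_comm (q + 1) k]
  norm_cast
  have h5 : 0 < k * (q + 1) + 1 := Nat.succ_pos _
  refine Nat.eq_of_mul_eq_mul_left h5 ?_
  rw [← mul_assoc, ← h4, mul_comm]
end
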